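/- arXiv:1703.09509 — 2 statements merged into one kernel-verified Lean document; each statement's English description precedes it below -/
import Mathlib

section
/- The limits x^γ_∞(μ) := sup_{n ≥ 1} x^γ_n(μ) of the reservation levels of the exponential-utility Bayesian house selling problem are finite (indeed x^γ_∞(μ) ≤ M − c) and satisfy the fixed point equation x^γ_∞(μ) = −c + (1/γ)·ln(∫ e^{γ·max{x, x^γ_∞(Φ(x, μ))}} Q_μ(dx)) for every probability measure μ on ℝ. -/
open MeasureTheory

/-- The distribution `Q_μ` of the next offer given the conditional distribution `μ` of the
unknown parameter: the measure on `ℝ` with `λ`-density `x ↦ ∫ q(x,θ) μ(dθ)`. -/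
noncomputable def offerMeasure (lam : Measure ℝ) (q : ℝ → ℝ → ℝ) (μ : Measure ℝ) :
    Measure ℝ :=
  lam.withDensity fun x => ENNReal.ofReal (∫ θ, q x θ ∂μ)

/-- The Bayes updating operator `Φ(x, μ)`: the measure with `μ`-density
`θ ↦ q(x,θ) / ∫ q(x,θ') μ(dθ')` when the denominator is positive, and `μ` otherwise. -/
noncomputable def bayesUpdate (q : ℝ → ℝ → ℝ) (x : ℝ) (μ : Measure ℝ) : Measure ℝ :=
  if 0 < ∫ θ, q x θ ∂μ then
    μ.withDensity fun θ => ENNReal.ofReal (q x θ / ∫ θ', q x θ' ∂μ)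
  else μ

/-- The reservation levels of the exponential-utility Bayesian house selling problem;
`resLevel lam q c γ n μ` is the reservation level `x^γ_{n+1}(μ)` with `n+1` remaining
stages:  `x^γ_1(μ) = −c + (1/γ)·ln ∫ e^{γx} Q_μ(dx)` and
`x^γ_{n+1}(μ) = −c + (1/γ)·ln ∫ e^{γ·max{x, x^γ_n(Φ(x,μ))}} Q_μ(dx)`. -/
noncomputable def resLevel (lam : Measure ℝ) (q : ℝ → ℝ → ℝ) (c γ : ℝ) :
    ℕ → Measure ℝ → ℝ
  | 0, μ => -c + (1 / γ) * Real.log (∫ x, Real.exp (γ * x) ∂(offerMeasure lam q μ))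
  | n + 1, μ => -c + (1 / γ) * Real.log (∫ x,
      Real.exp (γ * max x (resLevel lam q c γ n (bayesUpdate q x μ)))
        ∂(offerMeasure lam q μ))

open ProbabilityTheory Filter Topology

/-- The Bayes update of a probability measure is a probability measure. -/
theorem isProbabilityMeasure_bayesUpdate {q : ℝ → ℝ → ℝ} (hqnn : ∀ x θ, 0 ≤ q x θ) (x : ℝ)
    (μ : Measure ℝ) [hμ : IsProbabilityMeasure μ] :
    IsProbabilityMeasure (bayesUpdate q x μ) := by
  unfold bayesUpdate
  split_ifs with h
  · have hint : Integrable (q x) μ := by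
      by_contra hn
      exact h.ne' (integral_undef hn)
    refine ⟨?_⟩
    rw [withDensity_apply _ MeasurableSet.univ, Measure.restrict_univ,
      ← ofReal_integral_eq_lintegral_ofReal (hint.div_const _)
        (Eventually.of_forall fun θ => div_nonneg (hqnn x θ) h.le),
      integral_div, div_self h.ne', ENNReal.ofReal_one]
  · exact hμ

theorem measurable_integral_density {q : ℝ → ℝ → ℝ} (hq : Measurable (Function.uncurry q))
    (μ : Measure ℝ) [IsProbabilityMeasure μ] : Measurable fun x => ∫ θ, q x θ ∂μ :=
  (StronglyMeasurable.integral_prod_right hq.stronglyMeasurable).measurable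

/-- The distribution of the next offer is a probability measure. -/
theorem isProbabilityMeasure_offerMeasure (lam : Measure ℝ) [SigmaFinite lam] {q : ℝ → ℝ → ℝ}
    (hq : Measurable (Function.uncurry q)) (hqnn : ∀ x θ, 0 ≤ q x θ)
    (hqdens : ∀ θ, ∫ x, q x θ ∂lam = 1) (μ : Measure ℝ) [IsProbabilityMeasure μ] :
    IsProbabilityMeasure (offerMeasure lam q μ) := by
  have hsec : ∀ θ, ∫⁻ x, ENNReal.ofReal (q x θ) ∂lam = 1 := fun θ => by
    have hint : Integrable (fun x => q x θ) lam := by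
      by_contra hn
      simpa [integral_undef hn] using hqdens θ
    rw [← ofReal_integral_eq_lintegral_ofReal hint (Eventually.of_forall fun x => hqnn x θ),
      hqdens, ENNReal.ofReal_one]
  have hmeas : Measurable fun p : ℝ × ℝ => ENNReal.ofReal (q p.1 p.2) := hq.ennreal_ofReal
  have htot : ∫⁻ x, ∫⁻ θ, ENNReal.ofReal (q x θ) ∂μ ∂lam = 1 := by
    rw [lintegral_lintegral_swap hmeas.aemeasurable]
    simp [hsec]
  have hfin : ∀ᵐ x ∂lam, ∫⁻ θ, ENNReal.ofReal (q x θ) ∂μ < ⊤ :=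
    ae_lt_top hmeas.lintegral_prod_right' (by simp [htot])
  refine ⟨?_⟩
  rw [offerMeasure, withDensity_apply _ MeasurableSet.univ, Measure.restrict_univ, ← htot]
  refine lintegral_congr_ae ?_
  filter_upwards [hfin] with x hx
  rw [integral_eq_lintegral_of_nonneg_ae (Eventually.of_forall fun θ => hqnn x θ)
    (hq.comp measurable_prodMk_left).aestronglyMeasurable, ENNReal.ofReal_toReal hx.ne]

theorem ae_mem_Icc_offerMeasure (lam : Measure ℝ) {m M : ℝ} {q : ℝ → ℝ → ℝ}
    (hq : Measurable (Function.uncurry q)) (hqsupp : ∀ x θ, x ∉ Set.Icc m M → q x θ = 0)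
    (μ : Measure ℝ) [IsProbabilityMeasure μ] :
    ∀ᵐ x ∂(offerMeasure lam q μ), x ∈ Set.Icc m M := by
  rw [offerMeasure, ae_withDensity_iff (measurable_integral_density hq μ).ennreal_ofReal]
  refine Eventually.of_forall fun x hx => ?_
  by_contra hn
  simp [hqsupp x _ hn] at hx

section BoundedExponential

variable {Ω : Type*} [MeasurableSpace Ω] {ν : Measure Ω} [IsProbabilityMeasure ν] {γ m M : ℝ}

theorem exp_mul_mem_Icc_of_neg (hγ : γ < 0) {y : ℝ} (hy : y ∈ Set.Icc m M) :
    Real.exp (γ * y) ∈ Set.Icc (Real.exp (γ * M)) (Real.exp (γ * m)) :=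
  ⟨Real.exp_le_exp.2 (mul_le_mul_of_nonpos_left hy.2 hγ.le),
    Real.exp_le_exp.2 (mul_le_mul_of_nonpos_left hy.1 hγ.le)⟩

theorem mgf_antitone_of_neg (hγ : γ < 0) {f g : Ω → ℝ} (hf : AEMeasurable f ν)
    (hg : AEMeasurable g ν) (hfm : ∀ᵐ x ∂ν, f x ∈ Set.Icc m M)
    (hgm : ∀ᵐ x ∂ν, g x ∈ Set.Icc m M) (hfg : f ≤ᵐ[ν] g) : mgf g ν γ ≤ mgf f ν γ := by
  refine integral_mono_ae (integrable_exp_mul_of_mem_Icc hg hgm)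
    (integrable_exp_mul_of_mem_Icc hf hfm) ?_
  filter_upwards [hfg] with x hx
  exact Real.exp_le_exp.2 (mul_le_mul_of_nonpos_left hx hγ.le)

/-- The certainty equivalent of an exponential utility is monotone. -/
theorem cgf_div_monotone_of_neg (hγ : γ < 0) {f g : Ω → ℝ} (hf : AEMeasurable f ν)
    (hg : AEMeasurable g ν) (hfm : ∀ᵐ x ∂ν, f x ∈ Set.Icc m M)
    (hgm : ∀ᵐ x ∂ν, g x ∈ Set.Icc m M) (hfg : f ≤ᵐ[ν] g) :
    (1 / γ) * cgf f ν γ ≤ (1 / γ) * cgf g ν γ :=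
  mul_le_mul_of_nonpos_left
    (Real.log_le_log (mgf_pos (integrable_exp_mul_of_mem_Icc hg hgm))
      (mgf_antitone_of_neg hγ hf hg hfm hgm hfg))
    (one_div_nonpos.2 hγ.le)

theorem cgf_div_le_of_neg (hγ : γ < 0) {f : Ω → ℝ} (hf : AEMeasurable f ν)
    (hfm : ∀ᵐ x ∂ν, f x ∈ Set.Icc m M) : (1 / γ) * cgf f ν γ ≤ M := by
  obtain ⟨x, hx⟩ := hfm.exists
  have hle : m ≤ M := hx.1.trans hx.2
  have h := cgf_div_monotone_of_neg hγ hf (aemeasurable_const (b := M)) hfm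
    (Eventually.of_forall fun _ => ⟨hle, le_rfl⟩) (hfm.mono fun _ hx => hx.2)
  rwa [cgf_const, ← mul_assoc, one_div_mul_cancel hγ.ne, one_mul] at h

theorem tendsto_cgf_of_mem_Icc (hγ : γ < 0) {f : ℕ → Ω → ℝ} {g : Ω → ℝ}
    (hf : ∀ n, AEMeasurable (f n) ν) (hfm : ∀ n, ∀ᵐ x ∂ν, f n x ∈ Set.Icc m M)
    (hlim : ∀ᵐ x ∂ν, Tendsto (fun n => f n x) atTop (𝓝 (g x))) :
    Tendsto (fun n => cgf (f n) ν γ) atTop (𝓝 (cgf g ν γ)) := by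
  have hg : AEMeasurable g ν := aemeasurable_of_tendsto_metrizable_ae atTop hf hlim
  have hgm : ∀ᵐ x ∂ν, g x ∈ Set.Icc m M := by
    filter_upwards [hlim, ae_all_iff.2 hfm] with x hx hx'
    exact isClosed_Icc.mem_of_tendsto hx (Eventually.of_forall hx')
  refine Tendsto.log ?_ (mgf_pos (integrable_exp_mul_of_mem_Icc hg hgm)).ne'
  refine tendsto_integral_of_dominated_convergence (fun _ => Real.exp (γ * m))
    (fun n => ((hf n).const_mul γ).exp.aestronglyMeasurable)
    (integrable_const _) (fun n => ?_) ?_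
  · filter_upwards [hfm n] with x hx
    rw [Real.norm_eq_abs, Real.abs_exp]
    exact (exp_mul_mem_Icc_of_neg hγ hx).2
  · filter_upwards [hlim] with x hx
    exact (Real.continuous_exp.tendsto _).comp (hx.const_mul γ)

end BoundedExponential

/-- The infinite-horizon reservation levels `x^γ_∞(μ) = sup_{n ≥ 1} x^γ_n(μ)` of the
exponential-utility Bayesian house selling problem are finite (indeed bounded by `M − c`)
and satisfy the fixed point equation
`x^γ_∞(μ) = −c + (1/γ)·ln ∫ e^{γ·max{x, x^γ_∞(Φ(x,μ))}} Q_μ(dx)`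
(here `resLevel lam q c γ n = x^γ_{n+1}`, so `⨆ n, resLevel lam q c γ n μ = x^γ_∞(μ)`). -/
theorem resLevel_infinite_horizon_fixed_point
    (lam : Measure ℝ) [SigmaFinite lam] (m M : ℝ) (hmM : m < M)
    (q : ℝ → ℝ → ℝ) (hq : Measurable (Function.uncurry q))
    (hqnn : ∀ x θ, 0 ≤ q x θ)
    (hqdens : ∀ θ, ∫ x, q x θ ∂lam = 1)
    (hqsupp : ∀ x θ, x ∉ Set.Icc m M → q x θ = 0)
    (c : ℝ) (hc : 0 < c) (γ : ℝ) (hγ : γ < 0)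
    (hmeas : ∀ (n : ℕ) (μ : Measure ℝ), IsProbabilityMeasure μ →
      Measurable fun x => resLevel lam q c γ n (bayesUpdate q x μ)) :
    ∀ (μ : Measure ℝ), IsProbabilityMeasure μ →
      (⨆ n : ℕ, resLevel lam q c γ n μ) ≤ M - c ∧
      (⨆ n : ℕ, resLevel lam q c γ n μ)
        = -c + (1 / γ) * Real.log (∫ x,
            Real.exp (γ * max x (⨆ n : ℕ, resLevel lam q c γ n (bayesUpdate q x μ)))
              ∂(offerMeasure lam q μ)) := by
  have hQ : ∀ (μ : Measure ℝ), IsProbabilityMeasure μ →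
      IsProbabilityMeasure (offerMeasure lam q μ) := fun μ _ =>
    isProbabilityMeasure_offerMeasure lam hq hqnn hqdens μ
  have hsupp : ∀ (μ : Measure ℝ), IsProbabilityMeasure μ →
      ∀ᵐ x ∂(offerMeasure lam q μ), x ∈ Set.Icc m M := fun μ _ =>
    ae_mem_Icc_offerMeasure lam hq hqsupp μ
  have hΦ : ∀ (x : ℝ) (μ : Measure ℝ), IsProbabilityMeasure μ →
      IsProbabilityMeasure (bayesUpdate q x μ) := fun x μ _ =>
    isProbabilityMeasure_bayesUpdate hqnn x μ
  have hmax : ∀ (n : ℕ) (μ : Measure ℝ), IsProbabilityMeasure μ →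
      Measurable fun x => max x (resLevel lam q c γ n (bayesUpdate q x μ)) := fun n μ hμ =>
    measurable_id.max (hmeas n μ hμ)
  have hzero : ∀ μ, resLevel lam q c γ 0 μ
      = -c + (1 / γ) * cgf (fun x => x) (offerMeasure lam q μ) γ := fun _ => rfl
  have hsucc : ∀ n μ, resLevel lam q c γ (n + 1) μ
      = -c + (1 / γ) * cgf (fun x => max x (resLevel lam q c γ n (bayesUpdate q x μ)))
        (offerMeasure lam q μ) γ := fun _ _ => rfl
  have hmaxmem : ∀ n, (∀ μ, IsProbabilityMeasure μ → resLevel lam q c γ n μ ≤ M - c) →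
      ∀ μ, IsProbabilityMeasure μ → ∀ᵐ x ∂(offerMeasure lam q μ),
        max x (resLevel lam q c γ n (bayesUpdate q x μ)) ∈ Set.Icc m M := by
    intro n hn μ hμ
    filter_upwards [hsupp μ hμ] with x hx
    exact ⟨hx.1.trans (le_max_left _ _),
      max_le hx.2 ((hn _ (hΦ x μ hμ)).trans (by linarith))⟩
  have hub : ∀ n μ, IsProbabilityMeasure μ → resLevel lam q c γ n μ ≤ M - c := by
    intro n
    induction n with
    | zero =>
      intro μ hμ
      have := hQ μ hμ
      have := cgf_div_le_of_neg hγ aemeasurable_id' (hsupp μ hμ)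
      rw [hzero]
      linarith
    | succ n ih =>
      intro μ hμ
      have := hQ μ hμ
      have := cgf_div_le_of_neg hγ (hmax n μ hμ).aemeasurable (hmaxmem n ih μ hμ)
      rw [hsucc]
      linarith
  have hstep : ∀ n μ, IsProbabilityMeasure μ →
      resLevel lam q c γ n μ ≤ resLevel lam q c γ (n + 1) μ := by
    intro n
    induction n with
    | zero =>
      intro μ hμ
      have := hQ μ hμ
      rw [hzero, hsucc]
      exact add_le_add_right (cgf_div_monotone_of_neg hγ aemeasurable_id'
        (hmax 0 μ hμ).aemeasurable (hsupp μ hμ) (hmaxmem 0 (hub 0) μ hμ)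
        (Eventually.of_forall fun x => le_max_left _ _)) _
    | succ n ih =>
      intro μ hμ
      have := hQ μ hμ
      rw [hsucc, hsucc]
      exact add_le_add_right (cgf_div_monotone_of_neg hγ (hmax n μ hμ).aemeasurable
        (hmax (n + 1) μ hμ).aemeasurable (hmaxmem n (hub n) μ hμ)
        (hmaxmem (n + 1) (hub (n + 1)) μ hμ)
        (Eventually.of_forall fun x => max_le_max le_rfl (ih _ (hΦ x μ hμ)))) _
  have hlim : ∀ μ, IsProbabilityMeasure μ → Tendsto (fun n => resLevel lam q c γ n μ) atTop
      (𝓝 (⨆ n : ℕ, resLevel lam q c γ n μ)) := fun μ hμ =>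
    tendsto_atTop_ciSup (monotone_nat_of_le_succ fun n => hstep n μ hμ)
      ⟨M - c, Set.forall_mem_range.2 fun n => hub n μ hμ⟩
  intro μ hμ
  have := hQ μ hμ
  refine ⟨ciSup_le fun n => hub n μ hμ, tendsto_nhds_unique
    ((tendsto_add_atTop_iff_nat 1).2 (hlim μ hμ)) ?_⟩
  exact ((tendsto_cgf_of_mem_Icc hγ (fun n => (hmax n μ hμ).aemeasurable)
    (fun n => hmaxmem n (hub n) μ hμ) (Eventually.of_forall fun x =>
      tendsto_const_nhds.max (hlim _ (hΦ x μ hμ)))).const_mul (1 / γ)).const_add (-c)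
end

section
/- Suppose in addition that U is DARA in the sense that there exists an increasing concave function r : ℝ → ℝ with U(x − c) = r(U(x)) for all x ∈ ℝ (i.e., x ↦ U(x − c) is more risk averse than U). Then for every horizon N ≥ 1, every 0 ≤ n ≤ N − 2 and every information state μ ∈ I, the reservation levels satisfy x_{n+1,N}(μ) ≤ x_{n,N}(μ); that is, the reservation levels are decreasing in the time stage n. -/
open MeasureTheory ProbabilityTheory

/-- The reservation levels of the general-utility house selling problem, indexed by the
number of extra remaining stages and the current time stage: `resvLevel Q Φ c U k n μ` is
the reservation level `x_{n, N}(μ)` for the horizon `N = n + k + 1`.  With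
`U_n(x) = U(x − n·c)` and `U_n⁻¹(y) = n·c + U⁻¹(y)`, the backward recursion reads
`x_{N−1,N}(μ) = U_{N−1}⁻¹(∫ U_N(x) Q(μ,dx))` and
`x_{n,N}(μ) = U_n⁻¹(∫ U_{n+1}(max{x, x_{n+1,N}(Φ(x,μ))}) Q(μ,dx))`. -/
noncomputable def resvLevel {I : Type*} [MeasurableSpace I]
    (Q : Kernel I ℝ) (Φ : ℝ → I → I) (c : ℝ) (U : ℝ ≃o ℝ) : ℕ → ℕ → I → ℝ
  | 0, n, μ => (n : ℝ) * c + U.symm (∫ x, U (x - ((n : ℝ) + 1) * c) ∂(Q μ))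
  | k + 1, n, μ => (n : ℝ) * c + U.symm (∫ x,
      U (max x (resvLevel Q Φ c U k (n + 1) (Φ x μ)) - ((n : ℝ) + 1) * c) ∂(Q μ))

/-- A strictly increasing bijection of `ℝ`, composed with a shift of a measurable function
that is almost surely in a compact interval, is integrable. -/
lemma OrderIso.integrable_comp_sub_of_ae_mem_Icc {α : Type*} [MeasurableSpace α]
    {P : Measure α} [IsFiniteMeasure P] (U : ℝ ≃o ℝ) {f : α → ℝ} {m b : ℝ}
    (hf : Measurable f) (hmem : ∀ᵐ x ∂P, f x ∈ Set.Icc m b) (a : ℝ) :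
    Integrable (fun x => U (f x - a)) P := by
  refine Integrable.of_mem_Icc (U (m - a)) (U (b - a))
    (U.continuous.measurable.comp (hf.sub_const a)).aemeasurable ?_
  filter_upwards [hmem] with x hx
  exact ⟨U.monotone (by linarith [hx.1]), U.monotone (by linarith [hx.2])⟩

/-- The certainty equivalent of a random variable bounded above by `b` is at most `b`. -/
lemma OrderIso.symm_integral_le_of_ae_mem_Icc {α : Type*} [MeasurableSpace α]
    {P : Measure α} [IsProbabilityMeasure P] (U : ℝ ≃o ℝ) {f : α → ℝ} {m b : ℝ}
    (hf : Measurable f) (hmem : ∀ᵐ x ∂P, f x ∈ Set.Icc m b) (a : ℝ) :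
    U.symm (∫ x, U (f x - a) ∂P) ≤ b - a := by
  rw [U.symm_apply_le]
  calc ∫ x, U (f x - a) ∂P ≤ ∫ _, U (b - a) ∂P := by
        refine integral_mono_ae (U.integrable_comp_sub_of_ae_mem_Icc hf hmem a)
          (integrable_const _) ?_
        filter_upwards [hmem] with x hx
        exact U.monotone (by linarith [hx.2])
    _ = U (b - a) := by simp

/-- For DARA utilities, lowering the wealth by `c` lowers the certainty equivalent by at
least `c`. -/
lemma OrderIso.add_symm_integral_le_of_concaveOn {α : Type*} [MeasurableSpace α]
    {P : Measure α} [IsProbabilityMeasure P] (U : ℝ ≃o ℝ) {c : ℝ} {r : ℝ → ℝ}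
    (hr : ConcaveOn ℝ _root_.Set.univ r) (hDARA : ∀ x : ℝ, U (x - c) = r (U x))
    {f : α → ℝ} {m b : ℝ} (hf : Measurable f) (hmem : ∀ᵐ x ∂P, f x ∈ Set.Icc m b) (a : ℝ) :
    c + U.symm (∫ x, U (f x - (a + c)) ∂P) ≤ U.symm (∫ x, U (f x - a) ∂P) := by
  have hr_comp : r = fun y => U (U.symm y - c) := by
    funext y
    simp [hDARA]
  have hr_cont : Continuous r := by
    rw [hr_comp]
    exact U.continuous.comp (U.symm.continuous.sub continuous_const)
  have hshift : ∀ x, U (f x - (a + c)) = r (U (f x - a)) := fun x => by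
    rw [← hDARA, sub_sub]
  have hjensen : ∫ x, r (U (f x - a)) ∂P ≤ r (∫ x, U (f x - a) ∂P) := by
    refine hr.le_map_integral hr_cont.continuousOn isClosed_univ (by simp)
      (U.integrable_comp_sub_of_ae_mem_Icc hf hmem a) ?_
    have hint := U.integrable_comp_sub_of_ae_mem_Icc hf hmem (a + c)
    simp only [hshift] at hint
    exact hint
  have hle : U.symm (∫ x, U (f x - (a + c)) ∂P) ≤ U.symm (∫ x, U (f x - a) ∂P) - c := by
    rw [U.symm_apply_le, hDARA, U.apply_symm_apply]
    simpa only [hshift] using hjensen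
  linarith

section ReservationLevels

variable {I : Type*} [MeasurableSpace I] {Q : Kernel I ℝ} [IsMarkovKernel Q] {m b c : ℝ}
  {Φ : ℝ → I → I} {U : ℝ ≃o ℝ}

lemma resvLevel_le (hsupp : ∀ μ : I, Q μ (Set.Icc m b)ᶜ = 0) (hc : 0 ≤ c)
    (hmeas : ∀ (k n : ℕ) (μ : I), Measurable fun x => resvLevel Q Φ c U k (n + 1) (Φ x μ))
    (k n : ℕ) (μ : I) : resvLevel Q Φ c U k n μ ≤ b := by
  have hQ : ∀ᵐ x ∂(Q μ), x ∈ Set.Icc m b := hsupp μ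
  induction k generalizing n μ with
  | zero =>
    have h := U.symm_integral_le_of_ae_mem_Icc measurable_id hQ (((n : ℝ) + 1) * c)
    simp only [resvLevel, id] at h ⊢
    linarith
  | succ k ih =>
    have h := U.symm_integral_le_of_ae_mem_Icc (measurable_id.max (hmeas k n μ))
      (hQ.mono fun x hx => ⟨hx.1.trans (le_max_left _ _),
        max_le hx.2 (ih (n + 1) (Φ x μ) (hsupp _))⟩) (((n : ℝ) + 1) * c)
    simp only [resvLevel, id] at h ⊢
    linarith

lemma max_resvLevel_ae_mem_Icc (hsupp : ∀ μ : I, Q μ (Set.Icc m b)ᶜ = 0) (hc : 0 ≤ c)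
    (hmeas : ∀ (k n : ℕ) (μ : I), Measurable fun x => resvLevel Q Φ c U k (n + 1) (Φ x μ))
    (k n : ℕ) (μ : I) :
    ∀ᵐ x ∂(Q μ), max x (resvLevel Q Φ c U k n (Φ x μ)) ∈ Set.Icc m b := by
  have hQ : ∀ᵐ x ∂(Q μ), x ∈ Set.Icc m b := hsupp μ
  filter_upwards [hQ] with x hx
  exact ⟨hx.1.trans (le_max_left _ _), max_le hx.2 (resvLevel_le hsupp hc hmeas k n _)⟩

/-- An offer `f` that is dominated by the continuation value one stage earlier has a smaller
discounted certainty equivalent than the reservation level of that stage. -/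
lemma add_symm_integral_le_resvLevel_succ (hsupp : ∀ μ : I, Q μ (Set.Icc m b)ᶜ = 0) (hc : 0 ≤ c)
    (hmeas : ∀ (k n : ℕ) (μ : I), Measurable fun x => resvLevel Q Φ c U k (n + 1) (Φ x μ))
    {r : ℝ → ℝ} (hr : ConcaveOn ℝ Set.univ r) (hDARA : ∀ x : ℝ, U (x - c) = r (U x))
    {k n : ℕ} {μ : I} {f : ℝ → ℝ} (hf : Measurable f) (hmem : ∀ᵐ x ∂(Q μ), f x ∈ Set.Icc m b)
    (hle : ∀ x, f x ≤ max x (resvLevel Q Φ c U k (n + 1) (Φ x μ))) :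
    ((n + 1 : ℕ) : ℝ) * c + U.symm (∫ x, U (f x - (((n + 1 : ℕ) : ℝ) + 1) * c) ∂(Q μ)) ≤
      resvLevel Q Φ c U (k + 1) n μ := by
  have hdara := U.add_symm_integral_le_of_concaveOn hr hDARA hf hmem (((n : ℝ) + 1) * c)
  have hmono : U.symm (∫ x, U (f x - ((n : ℝ) + 1) * c) ∂(Q μ)) ≤
      U.symm (∫ x, U (max x (resvLevel Q Φ c U k (n + 1) (Φ x μ)) - ((n : ℝ) + 1) * c) ∂(Q μ)) :=
    U.symm.monotone <| integral_mono
      (U.integrable_comp_sub_of_ae_mem_Icc hf hmem _)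
      (U.integrable_comp_sub_of_ae_mem_Icc (measurable_id.max (hmeas k n μ))
        (max_resvLevel_ae_mem_Icc hsupp hc hmeas k (n + 1) μ) _)
      fun x => U.monotone (sub_le_sub_right (hle x) _)
  have hcast : (((n + 1 : ℕ) : ℝ) + 1) * c = ((n : ℝ) + 1) * c + c := by
    push_cast
    ring
  rw [hcast, resvLevel]
  push_cast
  linarith

lemma resvLevel_le_resvLevel_succ (hsupp : ∀ μ : I, Q μ (Set.Icc m b)ᶜ = 0) (hc : 0 ≤ c)
    (hmeas : ∀ (k n : ℕ) (μ : I), Measurable fun x => resvLevel Q Φ c U k (n + 1) (Φ x μ))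
    {r : ℝ → ℝ} (hr : ConcaveOn ℝ Set.univ r) (hDARA : ∀ x : ℝ, U (x - c) = r (U x))
    (k n : ℕ) (μ : I) :
    resvLevel Q Φ c U k (n + 1) μ ≤ resvLevel Q Φ c U (k + 1) n μ := by
  induction k generalizing n μ with
  | zero =>
    exact add_symm_integral_le_resvLevel_succ hsupp hc hmeas hr hDARA measurable_id
      (hsupp μ) fun x => le_max_left _ _
  | succ k ih =>
    exact add_symm_integral_le_resvLevel_succ hsupp hc hmeas hr hDARA
      (measurable_id.max (hmeas k (n + 1) μ))
      (max_resvLevel_ae_mem_Icc hsupp hc hmeas k (n + 2) μ)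
      fun x => max_le_max le_rfl (ih (n + 1) (Φ x μ))

end ReservationLevels

/-- If the utility `U` is DARA, in the sense that there is an increasing concave `r` with
`U(x − c) = r(U(x))` for all `x` (i.e. `x ↦ U(x − c)` is more risk averse than `U`), then
the reservation levels are decreasing in the time stage `n`: for every horizon `N ≥ 1` and
every `0 ≤ n ≤ N − 2`, `x_{n+1,N}(μ) ≤ x_{n,N}(μ)`
(here `x_{n,N} = resvLevel Q Φ c U (N − 1 − n) n`). -/
theorem reservation_levels_decreasing_in_time_of_DARA
    {I : Type*} [MeasurableSpace I]
    (Q : Kernel I ℝ) [IsMarkovKernel Q]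
    (m b : ℝ) (hmb : m ≤ b) (hsupp : ∀ μ : I, Q μ (Set.Icc m b)ᶜ = 0)
    (Φ : ℝ → I → I) (hΦ : Measurable (Function.uncurry Φ))
    (c : ℝ) (hc : 0 < c)
    (U : ℝ ≃o ℝ) (hUconc : ConcaveOn ℝ Set.univ U)
    (hmeas : ∀ (k n : ℕ) (μ : I),
      Measurable fun x => resvLevel Q Φ c U k (n + 1) (Φ x μ))
    (r : ℝ → ℝ) (hr : Monotone r) (hrconc : ConcaveOn ℝ Set.univ r)
    (hDARA : ∀ x : ℝ, U (x - c) = r (U x)) :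
    ∀ (N n : ℕ) (μ : I), 1 ≤ N → n + 2 ≤ N →
      resvLevel Q Φ c U (N - 2 - n) (n + 1) μ ≤ resvLevel Q Φ c U (N - 1 - n) n μ := by
  intro N n μ _ hn
  obtain ⟨k, rfl⟩ := Nat.exists_eq_add_of_le hn
  have hlate : n + 2 + k - 2 - n = k := by omega
  have hearly : n + 2 + k - 1 - n = k + 1 := by omega
  rw [hlate, hearly]
  exact resvLevel_le_resvLevel_succ hsupp hc.le hmeas hrconc hDARA k n μ
end
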